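/- Let (X,d) be a complete separable metric space and m a nonnegative Borel measure on X, finite on bounded sets. Let f : X → [0,∞) with f ∈ BV(X,d,m). Then the coarea formula ∫_0^∞ Per({f > t}) dt = |Df|(X) holds. -/

import Mathlib

open MeasureTheory Filter Topology ENNReal

/-- The slope (pointwise Lipschitz constant) of `f` at `x`, with the convention that it is `0`
at isolated points. -/
noncomputable def lipSlope {X : Type*} [MetricSpace X] (f : X → ℝ) (x : X) : ℝ :=
  Filter.limsup (fun y => |f y - f x| / dist y x) (𝓝[≠] x)

/-- Functions which are Lipschitz on bounded sets. -/
def LipLoc {X : Type*} [MetricSpace X] (f : X → ℝ) : Prop :=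
  ∀ s : Set X, Bornology.IsBounded s → ∃ K : NNReal, LipschitzOnWith K f s

/-- `f ∈ BV(X,d,m)`: `f ∈ L¹` and there is a sequence of locally Lipschitz functions
converging to `f` in `L¹` with bounded slope integrals. -/
def MemBV {X : Type*} [MetricSpace X] [MeasurableSpace X]
    (m : Measure X) (f : X → ℝ) : Prop :=
  Integrable f m ∧ ∃ g : ℕ → X → ℝ, (∀ n, LipLoc (g n)) ∧
    Tendsto (fun n => ∫⁻ x, ENNReal.ofReal |g n x - f x| ∂m) atTop (𝓝 0) ∧
    Filter.limsup (fun n => ∫⁻ x, ENNReal.ofReal (lipSlope (g n) x) ∂m) atTop < ⊤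

/-- The total variation `|Df|(X)` of a function `f`. -/
noncomputable def totalVar {X : Type*} [MetricSpace X] [MeasurableSpace X]
    (m : Measure X) (f : X → ℝ) : ℝ≥0∞ :=
  sInf { p : ℝ≥0∞ | ∃ g : ℕ → X → ℝ, (∀ n, LipLoc (g n)) ∧
    Tendsto (fun n => ∫⁻ x, ENNReal.ofReal |g n x - f x| ∂m) atTop (𝓝 0) ∧
    p = Filter.liminf (fun n => ∫⁻ x, ENNReal.ofReal (lipSlope (g n) x) ∂m) atTop }

/-- The perimeter of a Borel set `A`: the total variation of its indicator function. -/
noncomputable def perimeter {X : Type*} [MetricSpace X] [MeasurableSpace X]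
    (m : Measure X) (A : Set X) : ℝ≥0∞ :=
  totalVar m (A.indicator fun _ => (1:ℝ))


section Slope
variable {X : Type*} [MetricSpace X]

lemma LipLoc.continuous {f : X → ℝ} (hf : LipLoc f) : Continuous f := by
  rw [continuous_iff_continuousAt]
  intro x
  obtain ⟨K, hK⟩ := hf (Metric.ball x 1) Metric.isBounded_ball
  exact hK.continuousOn.continuousAt (Metric.ball_mem_nhds x one_pos)

lemma LipLoc.bdd {f : X → ℝ} (hf : LipLoc f) (x : X) :
    ∃ K : ℝ, 0 ≤ K ∧ ∀ᶠ y in 𝓝 x, |f y - f x| ≤ K * dist y x := by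
  obtain ⟨K, hK⟩ := hf (Metric.ball x 1) Metric.isBounded_ball
  refine ⟨K, K.2, ?_⟩
  filter_upwards [Metric.ball_mem_nhds x one_pos] with y hy
  have := hK.dist_le_mul y hy x (Metric.mem_ball_self one_pos)
  rwa [Real.dist_eq] at this

lemma quot_le_iff {f : X → ℝ} {x : X} {a : ℝ} :
    (∀ᶠ y in 𝓝[≠] x, |f y - f x| / dist y x ≤ a) ↔
      ∀ᶠ y in 𝓝 x, |f y - f x| ≤ a * dist y x := by
  rw [eventually_nhdsWithin_iff]
  apply eventually_congr
  refine Eventually.of_forall fun y => ?_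
  by_cases h : y = x
  · simp [h]
  · have : 0 < dist y x := dist_pos.2 h
    simp [h, div_le_iff₀ this]

lemma lipSlope_isolated {f : X → ℝ} {x : X} (h : 𝓝[≠] x = ⊥) : lipSlope f x = 0 := by
  simp [lipSlope, h, Filter.limsup, Filter.limsSup]

lemma lipSlope_nonneg {f : X → ℝ} (hf : LipLoc f) (x : X) : 0 ≤ lipSlope f x := by
  rcases eq_or_neBot (𝓝[≠] x) with h | h
  · rw [lipSlope_isolated h]
  · obtain ⟨K, hK0, hK⟩ := hf.bdd x
    refine le_limsup_of_frequently_le (Frequently.of_forall fun y => by positivity) ?_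
    exact ⟨K, by simpa using quot_le_iff.2 hK⟩

lemma lipSlope_le {f : X → ℝ} {x : X} {a : ℝ} (ha : 0 ≤ a)
    (h : ∀ᶠ y in 𝓝 x, |f y - f x| ≤ a * dist y x) : lipSlope f x ≤ a := by
  rcases eq_or_neBot (𝓝[≠] x) with h0 | h0
  · rwa [lipSlope_isolated h0]
  · refine limsup_le_of_le ?_ (quot_le_iff.2 h)
    refine IsBoundedUnder.isCoboundedUnder_le ⟨0, ?_⟩
    simp only [eventually_map]
    exact Eventually.of_forall fun y => by positivity

lemma lipSlope_lt {f : X → ℝ} (hf : LipLoc f) {x : X} {a : ℝ} (h : lipSlope f x < a) :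
    ∀ᶠ y in 𝓝 x, |f y - f x| ≤ a * dist y x := by
  obtain ⟨K, hK0, hK⟩ := hf.bdd x
  rw [← quot_le_iff]
  have := eventually_lt_of_limsup_lt (f := 𝓝[≠] x) h ⟨K, by simpa using quot_le_iff.2 hK⟩
  exact this.mono fun y hy => hy.le

lemma lipSlope_lt_iff {f : X → ℝ} (hf : LipLoc f) {x : X} {c : ℝ} :
    lipSlope f x < c ↔ ∃ q : ℚ, (0 ≤ (q:ℝ) ∧ (q:ℝ) < c) ∧ ∃ n : ℕ,
      ∀ y, dist y x < 1 / ((n:ℝ) + 1) → |f y - f x| ≤ q * dist y x := by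
  constructor
  · intro h
    obtain ⟨q, hq1, hq2⟩ := exists_rat_btwn h
    refine ⟨q, ⟨(lipSlope_nonneg hf x).trans hq1.le, hq2⟩, ?_⟩
    obtain ⟨ε, hε, H⟩ := Metric.eventually_nhds_iff.1 (lipSlope_lt hf hq1)
    obtain ⟨n, hn⟩ := exists_nat_one_div_lt hε
    exact ⟨n, fun y hy => H (hy.trans hn)⟩
  · rintro ⟨q, ⟨h0, hc⟩, n, H⟩
    refine lt_of_le_of_lt (lipSlope_le h0 ?_) hc
    exact Metric.eventually_nhds_iff.2 ⟨_, Nat.one_div_pos_of_nat, fun y hy => H y hy⟩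

lemma measurable_lipSlope [MeasurableSpace X] [BorelSpace X] {f : X → ℝ} (hf : LipLoc f) :
    Measurable (lipSlope f) := by
  have hc := hf.continuous
  apply measurable_of_Iio
  intro c
  have : lipSlope f ⁻¹' Set.Iio c = ⋃ q : ℚ, ⋃ (_ : 0 ≤ (q:ℝ) ∧ (q:ℝ) < c), ⋃ n : ℕ,
      {x | ∀ y, dist y x < 1 / ((n:ℝ) + 1) → |f y - f x| ≤ q * dist y x} := by
    ext x
    simp only [Set.mem_preimage, Set.mem_Iio, lipSlope_lt_iff hf, Set.mem_iUnion, Set.mem_ofPred_eq,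
      exists_prop]
  rw [this]
  refine MeasurableSet.iUnion fun q => MeasurableSet.iUnion fun _ => MeasurableSet.iUnion fun n =>
    IsClosed.measurableSet ?_
  rw [Set.ofPred_forall]
  refine isClosed_iInter fun y => ?_
  have : {x | dist y x < 1 / ((n:ℝ) + 1) → |f y - f x| ≤ q * dist y x} =
    {x | 1 / ((n:ℝ) + 1) ≤ dist y x} ∪ {x | |f y - f x| ≤ q * dist y x} := by
    ext x
    simp only [Set.mem_ofPred_eq, Set.mem_union]
    rw [imp_iff_not_or, not_lt]
  rw [this]
  exact (isClosed_le (by fun_prop) (by fun_prop)).union (isClosed_le (by fun_prop) (by fun_prop))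

lemma LipLoc.add {f g : X → ℝ} (hf : LipLoc f) (hg : LipLoc g) : LipLoc (fun x => f x + g x) := by
  intro s hs
  obtain ⟨K, hK⟩ := hf s hs
  obtain ⟨L, hL⟩ := hg s hs
  exact ⟨K + L, hK.add hL⟩

lemma LipLoc.comp {f : X → ℝ} (hf : LipLoc f) {φ : ℝ → ℝ} {L : NNReal} (hφ : LipschitzWith L φ) :
    LipLoc (fun x => φ (f x)) := by
  intro s hs
  obtain ⟨K, hK⟩ := hf s hs
  exact ⟨L * K, hφ.comp_lipschitzOnWith hK⟩

lemma lipSlope_add_le {f g : X → ℝ} (hf : LipLoc f) (hg : LipLoc g) (x : X) :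
    lipSlope (fun x => f x + g x) x ≤ lipSlope f x + lipSlope g x := by
  refine le_of_forall_pos_le_add fun ε hε => ?_
  have h1 := lipSlope_lt hf (show lipSlope f x < lipSlope f x + ε / 2 by linarith)
  have h2 := lipSlope_lt hg (show lipSlope g x < lipSlope g x + ε / 2 by linarith)
  have h3 := lipSlope_nonneg hf x
  have h4 := lipSlope_nonneg hg x
  refine lipSlope_le (by linarith) ?_
  filter_upwards [h1, h2] with y hy1 hy2
  calc |f y + g y - (f x + g x)| = |(f y - f x) + (g y - g x)| := by ring_nf
    _ ≤ _ := abs_add_le _ _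
    _ ≤ _ := add_le_add hy1 hy2
    _ = _ := by ring

lemma lipSlope_comp_le {f : X → ℝ} (hf : LipLoc f) {φ : ℝ → ℝ} {L : NNReal}
    (hφ : LipschitzWith L φ) (x : X) :
    lipSlope (fun x => φ (f x)) x ≤ L * lipSlope f x := by
  have h3 := lipSlope_nonneg hf x
  have key : ∀ ε > 0, lipSlope (fun x => φ (f x)) x ≤ L * (lipSlope f x + ε) := by
    intro ε hε
    refine lipSlope_le (by positivity) ?_
    filter_upwards [lipSlope_lt hf (show lipSlope f x < lipSlope f x + ε by linarith)] with y hy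
    have := hφ.dist_le_mul (f y) (f x)
    rw [Real.dist_eq, Real.dist_eq] at this
    calc _ ≤ _ := this
      _ ≤ L * ((lipSlope f x + ε) * dist y x) := by gcongr
      _ = _ := by ring
  refine ge_of_tendsto (x := 𝓝[>] (0:ℝ)) (f := fun ε => L * (lipSlope f x + ε)) ?_
    (eventually_mem_nhdsWithin.mono key)
  have : Tendsto (fun ε : ℝ => L * (lipSlope f x + ε)) (𝓝 0) (𝓝 (L * (lipSlope f x + 0))) :=
    Continuous.tendsto (by fun_prop) 0
  rw [add_zero] at this
  exact this.mono_left nhdsWithin_le_nhds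

lemma lipSlope_eventuallyConst {f : X → ℝ} {x : X} (h : ∀ᶠ y in 𝓝 x, f y = f x) :
    lipSlope f x ≤ 0 :=
  lipSlope_le le_rfl (h.mono fun y hy => by simp [hy])

end Slope

/-- cutoff -/
noncomputable def cutoff (k : ℕ) (t : ℝ) (y : ℝ) : ℝ := min 1 (max 0 (((k:ℝ) + 1) * (y - t)))

lemma cutoff_lip (k : ℕ) (t : ℝ) : LipschitzWith ((k:NNReal) + 1) (cutoff k t) := by
  have : LipschitzWith ((k:NNReal) + 1) (fun y : ℝ => ((k:ℝ) + 1) * (y - t)) := by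
    refine LipschitzWith.of_dist_le_mul fun x y => ?_
    rw [Real.dist_eq, Real.dist_eq, ← mul_sub, abs_mul]
    have : |(k:ℝ) + 1| = k + 1 := abs_of_pos (by positivity)
    rw [this]
    simp
  exact (this.const_max 0).const_min 1

lemma cutoff_of_le {k : ℕ} {t y : ℝ} (h : y ≤ t) : cutoff k t y = 0 := by
  have : ((k:ℝ) + 1) * (y - t) ≤ 0 := mul_nonpos_of_nonneg_of_nonpos (by positivity) (by linarith)
  simp [cutoff, this]

lemma cutoff_of_ge {k : ℕ} {t y : ℝ} (h : t + 1 / ((k:ℝ) + 1) ≤ y) : cutoff k t y = 1 := by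
  have : 1 ≤ ((k:ℝ) + 1) * (y - t) := by
    have h1 : 1 / ((k:ℝ) + 1) ≤ y - t := by linarith
    rw [div_le_iff₀ (by positivity)] at h1
    linarith
  simp [cutoff, this]

lemma cutoff_mem (k : ℕ) (t y : ℝ) : 0 ≤ cutoff k t y ∧ cutoff k t y ≤ 1 := by
  simp [cutoff]

lemma lipSlope_cutoff {X : Type*} [MetricSpace X] {g : X → ℝ} (hg : LipLoc g) (k : ℕ) (t : ℝ)
    (x : X) : lipSlope (fun x => cutoff k t (g x)) x ≤
      if t ≤ g x ∧ g x ≤ t + 1 / ((k:ℝ) + 1) then ((k:ℝ) + 1) * lipSlope g x else 0 := by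
  have hc := hg.continuous
  split_ifs with h
  · simpa using lipSlope_comp_le hg (cutoff_lip k t) x
  · apply lipSlope_eventuallyConst
    by_cases h1 : t ≤ g x
    · have h2 : t + 1 / ((k:ℝ) + 1) < g x := by
        by_contra h3
        exact h ⟨h1, not_lt.1 h3⟩
      filter_upwards [hc.continuousAt.eventually (lt_mem_nhds h2)] with y hy
      rw [cutoff_of_ge hy.le, cutoff_of_ge h2.le]
    · have h2 : g x < t := not_le.1 h1
      filter_upwards [hc.continuousAt.eventually (gt_mem_nhds h2)] with y hy
      rw [cutoff_of_le hy.le, cutoff_of_le h2.le]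

section TV
variable {X : Type*} [MetricSpace X] [MeasurableSpace X] {m : Measure X}

lemma exists_of_totalVar_lt {u : X → ℝ} {p : ℝ≥0∞} (h : totalVar m u < p) {ε : ℝ≥0∞} (hε : 0 < ε) :
    ∃ g : X → ℝ, LipLoc g ∧ ∫⁻ x, ENNReal.ofReal |g x - u x| ∂m < ε ∧
      ∫⁻ x, ENNReal.ofReal (lipSlope g x) ∂m < p := by
  obtain ⟨_, ⟨g, hg, hgu, rfl⟩, hlt⟩ := sInf_lt_iff.1 h
  have h1 := frequently_lt_of_liminf_lt (by isBoundedDefault) hlt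
  have h2 := hgu.eventually (gt_mem_nhds hε)
  obtain ⟨n, hn1, hn2⟩ := (h1.and_eventually h2).exists
  exact ⟨g n, hg n, hn2, hn1⟩

lemma totalVar_le_of {u : X → ℝ} {p : ℝ≥0∞}
    (h : ∀ ε : ℝ≥0∞, 0 < ε → ∃ g : X → ℝ, LipLoc g ∧ ∫⁻ x, ENNReal.ofReal |g x - u x| ∂m ≤ ε ∧
      ∫⁻ x, ENNReal.ofReal (lipSlope g x) ∂m ≤ p) : totalVar m u ≤ p := by
  have h' : ∀ n : ℕ, ∃ g : X → ℝ, LipLoc g ∧ ∫⁻ x, ENNReal.ofReal |g x - u x| ∂m ≤ (n:ℝ≥0∞)⁻¹ ∧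
      ∫⁻ x, ENNReal.ofReal (lipSlope g x) ∂m ≤ p := fun n => h _ (by simp)
  choose g hg1 hg2 hg3 using h'
  have : totalVar m u ≤ Filter.liminf (fun n => ∫⁻ x, ENNReal.ofReal (lipSlope (g n) x) ∂m) atTop := by
    refine sInf_le ⟨g, hg1, ?_, rfl⟩
    exact tendsto_of_tendsto_of_tendsto_of_le_of_le tendsto_const_nhds
      ENNReal.tendsto_inv_nat_nhds_zero (fun n => zero_le) hg2
  refine this.trans ?_
  calc _ ≤ Filter.liminf (fun n : ℕ => p) atTop := liminf_le_liminf (Eventually.of_forall hg3)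
    _ = p := by simp

lemma l1_triangle [BorelSpace X] {g v u : X → ℝ} (hg : LipLoc g) (hv : AEMeasurable v m) :
    ∫⁻ x, ENNReal.ofReal |g x - u x| ∂m ≤
      ∫⁻ x, ENNReal.ofReal |g x - v x| ∂m + ∫⁻ x, ENNReal.ofReal |v x - u x| ∂m := by
  have hgm : Measurable g := hg.continuous.measurable
  rw [← lintegral_add_left' (by fun_prop)]
  refine lintegral_mono fun x => ?_
  rw [← ENNReal.ofReal_add (abs_nonneg _) (abs_nonneg _)]
  exact ENNReal.ofReal_le_ofReal (abs_sub_le _ _ _)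

lemma totalVar_lsc [BorelSpace X] {v : ℕ → X → ℝ} {u : X → ℝ} (hv : ∀ n, AEMeasurable (v n) m)
    (h : Tendsto (fun n => ∫⁻ x, ENNReal.ofReal |v n x - u x| ∂m) atTop (𝓝 0)) :
    totalVar m u ≤ liminf (fun n => totalVar m (v n)) atTop := by
  refine le_of_forall_gt fun q hq => ?_
  obtain ⟨q', hq1, hq2⟩ := exists_between hq
  refine lt_of_le_of_lt (totalVar_le_of fun ε hε => ?_) hq2
  have h1 := frequently_lt_of_liminf_lt (by isBoundedDefault) hq1
  have h2 := h.eventually (gt_mem_nhds (ENNReal.half_pos hε.ne'))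
  obtain ⟨n, hn1, hn2⟩ := (h1.and_eventually h2).exists
  obtain ⟨g, hg, hg1, hg2⟩ := exists_of_totalVar_lt hn1 (ENNReal.half_pos hε.ne')
  refine ⟨g, hg, ?_, hg2.le⟩
  calc _ ≤ _ := l1_triangle hg (hv n)
    _ ≤ ε / 2 + ε / 2 := add_le_add hg1.le hn2.le
    _ = ε := ENNReal.add_halves ε

lemma totalVar_zero : totalVar m (fun _ => (0:ℝ)) = 0 := by
  refine le_antisymm (totalVar_le_of fun ε hε => ⟨fun _ => 0, ?_, by simp, ?_⟩) zero_le
  · intro s _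
    exact ⟨0, (LipschitzWith.const 0).lipschitzOnWith⟩
  · have : ∀ x : X, ENNReal.ofReal (lipSlope (fun _ : X => (0:ℝ)) x) = 0 := fun x =>
      ENNReal.ofReal_eq_zero.2 (lipSlope_eventuallyConst (by simp))
    simp [this]

lemma totalVar_add_le [BorelSpace X] {u v : X → ℝ} (hu : AEMeasurable u m) :
    totalVar m (fun x => u x + v x) ≤ totalVar m u + totalVar m v := by
  by_cases hut : totalVar m u = ⊤
  · simp [hut]
  by_cases hvt : totalVar m v = ⊤
  · simp [hvt]
  refine ENNReal.le_of_forall_pos_le_add fun δ hδ _ => ?_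
  have hδ' : (0:ℝ≥0∞) < δ := by exact_mod_cast hδ
  refine totalVar_le_of fun ε hε => ?_
  have hd2 := ENNReal.half_pos hδ'.ne'
  obtain ⟨g, hg, hg1, hg2⟩ := exists_of_totalVar_lt
    (ENNReal.lt_add_right hut hd2.ne') (ENNReal.half_pos hε.ne')
  obtain ⟨h, hh, hh1, hh2⟩ := exists_of_totalVar_lt
    (ENNReal.lt_add_right hvt hd2.ne') (ENNReal.half_pos hε.ne')
  have hgm : Measurable g := hg.continuous.measurable
  have hgl := measurable_lipSlope hg
  refine ⟨_, hg.add hh, ?_, ?_⟩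
  · calc _ ≤ ∫⁻ x, (ENNReal.ofReal |g x - u x| + ENNReal.ofReal |h x - v x|) ∂m := by
          refine lintegral_mono fun x => ?_
          rw [← ENNReal.ofReal_add (abs_nonneg _) (abs_nonneg _)]
          refine ENNReal.ofReal_le_ofReal ?_
          rw [add_sub_add_comm]
          exact abs_add_le _ _
      _ = _ := lintegral_add_left' (by fun_prop) _
      _ ≤ ε / 2 + ε / 2 := add_le_add hg1.le hh1.le
      _ = ε := ENNReal.add_halves ε
  · calc _ ≤ ∫⁻ x, (ENNReal.ofReal (lipSlope g x) + ENNReal.ofReal (lipSlope h x)) ∂m := by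
          refine lintegral_mono fun x => ?_
          rw [← ENNReal.ofReal_add (lipSlope_nonneg hg x) (lipSlope_nonneg hh x)]
          exact ENNReal.ofReal_le_ofReal (lipSlope_add_le hg hh x)
      _ = _ := lintegral_add_left' (by fun_prop) _
      _ ≤ _ := add_le_add hg2.le hh2.le
      _ = totalVar m u + totalVar m v + (δ / 2 + δ / 2) := by ring
      _ = _ := by rw [ENNReal.add_halves]

lemma totalVar_sum_le [BorelSpace X] (u : ℕ → X → ℝ) (hu : ∀ j, AEMeasurable (u j) m) (M : ℕ) :
    totalVar m (fun x => ∑ j ∈ Finset.range M, u j x) ≤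
      ∑ j ∈ Finset.range M, totalVar m (u j) := by
  induction M with
  | zero => simp [totalVar_zero]
  | succ M ih =>
    simp only [Finset.sum_range_succ]
    refine (totalVar_add_le ?_).trans (by gcongr)
    exact Finset.aemeasurable_fun_sum _ fun j _ => hu j

lemma totalVar_smul_le [BorelSpace X] {u : X → ℝ} {c : NNReal} (hc : 0 < c) :
    totalVar m (fun x => (c:ℝ) * u x) ≤ c * totalVar m u := by
  have hc0 : (c:ℝ≥0∞) ≠ 0 := by exact_mod_cast hc.ne'
  have hct : (c:ℝ≥0∞) ≠ ⊤ := ENNReal.coe_ne_top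
  have key : ∀ q, totalVar m u < q → totalVar m (fun x => (c:ℝ) * u x) ≤ c * q := by
    intro q hq
    refine totalVar_le_of fun ε hε => ?_
    obtain ⟨g, hg, hg1, hg2⟩ := exists_of_totalVar_lt hq (ENNReal.div_pos hε.ne' hct)
    have hφ : LipschitzWith c (fun y : ℝ => (c:ℝ) * y) :=
      LipschitzWith.of_dist_le_mul fun x y => by
        rw [Real.dist_eq, Real.dist_eq, ← mul_sub, abs_mul, abs_of_nonneg (NNReal.coe_nonneg c)]
    refine ⟨_, hg.comp hφ, ?_, ?_⟩
    · calc _ = ∫⁻ x, c * ENNReal.ofReal |g x - u x| ∂m := by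
            refine lintegral_congr fun x => ?_
            rw [← mul_sub, abs_mul, abs_of_nonneg (NNReal.coe_nonneg c), ENNReal.ofReal_mul (NNReal.coe_nonneg c),
              ENNReal.ofReal_coe_nnreal]
        _ = c * ∫⁻ x, ENNReal.ofReal |g x - u x| ∂m := lintegral_const_mul' _ _ hct
        _ ≤ c * (ε / c) := by gcongr
        _ = ε := ENNReal.mul_div_cancel hc0 hct
    · calc _ ≤ ∫⁻ x, c * ENNReal.ofReal (lipSlope g x) ∂m := by
            refine lintegral_mono fun x => ?_
            rw [← ENNReal.ofReal_coe_nnreal, ← ENNReal.ofReal_mul (NNReal.coe_nonneg c)]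
            exact ENNReal.ofReal_le_ofReal (lipSlope_comp_le hg hφ x)
        _ = c * ∫⁻ x, ENNReal.ofReal (lipSlope g x) ∂m := lintegral_const_mul' _ _ hct
        _ ≤ c * q := by gcongr
  rw [mul_comm, ← ENNReal.div_le_iff_le_mul (Or.inl hc0) (Or.inl hct)]
  refine le_of_forall_gt_imp_ge_of_dense fun q hq => ?_
  rw [ENNReal.div_le_iff_le_mul (Or.inl hc0) (Or.inl hct), mul_comm]
  exact key q hq

end TV

section Main
variable {X : Type*} [MetricSpace X] [MeasurableSpace X] [BorelSpace X] {m : Measure X}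

lemma aemeasurable_superlevel {f : X → ℝ} (hf : AEMeasurable f m) (t : ℝ) :
    AEMeasurable ({x | t < f x}.indicator fun _ => (1:ℝ)) m :=
  aemeasurable_const.indicator₀ (nullMeasurableSet_lt aemeasurable_const hf)

lemma cutoff_tendsto {f : X → ℝ} (hnonneg : ∀ x, 0 ≤ f x) (hf : Integrable f m) {t : ℝ}
    (ht : 0 < t) :
    Tendsto (fun k : ℕ => ∫⁻ x, ENNReal.ofReal
      |cutoff k t (f x) - {x | t < f x}.indicator (fun _ => (1:ℝ)) x| ∂m) atTop (𝓝 0) := by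
  have hfm := hf.aemeasurable
  have hi := aemeasurable_superlevel hfm t
  have hb : ∫⁻ x, ENNReal.ofReal (f x / t) ∂m ≠ ⊤ := by
    have := (hf.div_const t).lintegral_lt_top
    exact this.ne
  have := tendsto_lintegral_of_dominated_convergence' (μ := m)
    (F := fun (k : ℕ) x => ENNReal.ofReal
      |cutoff k t (f x) - {x | t < f x}.indicator (fun _ => (1:ℝ)) x|) (f := fun _ => 0)
    (fun x => ENNReal.ofReal (f x / t)) ?_ ?_ hb ?_
  · simpa using this
  · intro k
    have : Measurable (cutoff k t) := (cutoff_lip k t).continuous.measurable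
    have := this.comp_aemeasurable hfm
    exact ((this.sub hi).abs).ennreal_ofReal
  · intro k
    refine Eventually.of_forall fun x => ENNReal.ofReal_le_ofReal ?_
    by_cases h : t < f x
    · have h1 : 1 ≤ f x / t := by rw [le_div_iff₀ ht]; linarith
      have := cutoff_mem k t (f x)
      rw [Set.indicator_of_mem (by exact h), abs_le]
      constructor <;> linarith
    · rw [Set.indicator_of_notMem (by exact h), cutoff_of_le (not_lt.1 h)]
      simp only [sub_self, abs_zero]
      exact div_nonneg (hnonneg x) ht.le
  · refine Eventually.of_forall fun x => ?_
    refine tendsto_const_nhds.congr' ?_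
    by_cases h : t < f x
    · obtain ⟨n, hn⟩ := exists_nat_one_div_lt (sub_pos.2 h)
      filter_upwards [eventually_ge_atTop n] with k hk
      have h2 : 1 / ((k:ℝ) + 1) ≤ 1 / ((n:ℝ) + 1) := by gcongr
      rw [Set.indicator_of_mem (by exact h), cutoff_of_ge (by linarith)]
      simp
    · refine Eventually.of_forall fun k => ?_
      simp only
      rw [Set.indicator_of_notMem (by exact h), cutoff_of_le (not_lt.1 h)]
      simp

lemma cutoff_comp_tendsto {f : X → ℝ} {g : ℕ → X → ℝ}
    (h : Tendsto (fun n => ∫⁻ x, ENNReal.ofReal |g n x - f x| ∂m) atTop (𝓝 0)) (k : ℕ) (t : ℝ) :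
    Tendsto (fun n => ∫⁻ x, ENNReal.ofReal |cutoff k t (g n x) - cutoff k t (f x)| ∂m)
      atTop (𝓝 0) := by
  have h2 := ENNReal.Tendsto.const_mul (a := (((k:NNReal) + 1 : NNReal) : ℝ≥0∞)) h
    (Or.inr ENNReal.coe_ne_top)
  rw [mul_zero] at h2
  refine tendsto_of_tendsto_of_tendsto_of_le_of_le tendsto_const_nhds h2 (fun n => zero_le) ?_
  intro n
  simp only
  rw [← lintegral_const_mul' _ _ ENNReal.coe_ne_top]
  refine lintegral_mono fun x => ?_
  rw [← ENNReal.ofReal_coe_nnreal, ← ENNReal.ofReal_mul (NNReal.coe_nonneg _)]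
  refine ENNReal.ofReal_le_ofReal ?_
  have := (cutoff_lip k t).dist_le_mul (g n x) (f x)
  rwa [Real.dist_eq, Real.dist_eq] at this

/-- kernel -/
noncomputable def kern (g : X → ℝ) (k : ℕ) (t : ℝ) (x : X) : ℝ≥0∞ :=
  Set.indicator {p : ℝ × X | p.1 ≤ g p.2 ∧ g p.2 ≤ p.1 + 1 / ((k:ℝ) + 1)}
    (fun p => ENNReal.ofReal (((k:ℝ) + 1) * lipSlope g p.2)) (t, x)

lemma kern_measurable {g : X → ℝ} (hg : LipLoc g) (k : ℕ) :
    Measurable (fun p : ℝ × X => kern g k p.1 p.2) := by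
  have hgm : Measurable g := hg.continuous.measurable
  have hgl := measurable_lipSlope hg
  refine Measurable.indicator (by fun_prop) ?_
  have h1 : MeasurableSet {p : ℝ × X | p.1 ≤ g p.2} :=
    measurableSet_le (by fun_prop) (by fun_prop)
  have h2 : MeasurableSet {p : ℝ × X | g p.2 ≤ p.1 + 1 / ((k:ℝ) + 1)} :=
    measurableSet_le (by fun_prop) (by fun_prop)
  exact h1.inter h2

lemma kern_lintegral_measurable [SFinite m] {g : X → ℝ} (hg : LipLoc g) (k : ℕ) :
    Measurable (fun t => ∫⁻ x, kern g k t x ∂m) :=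
  (kern_measurable hg k).lintegral_prod_right'

lemma kern_lintegral [SFinite m] {g : X → ℝ} (hg : LipLoc g) (k : ℕ) :
    ∫⁻ t in Set.Ioi (0:ℝ), ∫⁻ x, kern g k t x ∂m ≤ ∫⁻ x, ENNReal.ofReal (lipSlope g x) ∂m := by
  rw [lintegral_lintegral_swap (kern_measurable hg k).aemeasurable]
  refine lintegral_mono fun x => ?_
  have hk : (0:ℝ) < (k:ℝ) + 1 := by positivity
  calc _ ≤ ∫⁻ t, kern g k t x := setLIntegral_le_lintegral _ _
    _ = ∫⁻ t, (Set.Icc (g x - 1 / ((k:ℝ) + 1)) (g x)).indicator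
          (fun _ => ENNReal.ofReal (((k:ℝ) + 1) * lipSlope g x)) t := by
        refine lintegral_congr fun t => ?_
        unfold kern
        by_cases h : t ≤ g x ∧ g x ≤ t + 1 / ((k:ℝ) + 1)
        · rw [Set.indicator_of_mem (by exact h), Set.indicator_of_mem]
          exact ⟨by linarith [h.2], h.1⟩
        · rw [Set.indicator_of_notMem (by exact h), Set.indicator_of_notMem]
          rintro ⟨h1, h2⟩
          exact h ⟨h2, by linarith⟩
    _ = ENNReal.ofReal (lipSlope g x) := by
        rw [lintegral_indicator_const measurableSet_Icc, Real.volume_Icc,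
          ← ENNReal.ofReal_mul (mul_nonneg hk.le (lipSlope_nonneg hg x))]
        congr 1
        field_simp
        ring
    _ ≤ _ := le_rfl

lemma coarea_le [SFinite m] {f : X → ℝ} (hnonneg : ∀ x, 0 ≤ f x) (hf : Integrable f m) :
    ∫⁻ t in Set.Ioi (0:ℝ), perimeter m {x | t < f x} ≤ totalVar m f := by
  refine le_sInf ?_
  rintro _ ⟨g, hg, hgf, rfl⟩
  have hfm := hf.aemeasurable
  have key : ∀ t ∈ Set.Ioi (0:ℝ), perimeter m {x | t < f x} ≤
      liminf (fun k => liminf (fun n => ∫⁻ x, kern (g n) k t x ∂m) atTop) atTop := by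
    intro t ht
    refine (totalVar_lsc (v := fun k x => cutoff k t (f x)) ?_
      (cutoff_tendsto hnonneg hf ht)).trans ?_
    · exact fun k => (cutoff_lip k t).continuous.measurable.comp_aemeasurable hfm
    refine liminf_le_liminf (Eventually.of_forall fun k => ?_)
    have : totalVar m (fun x => cutoff k t (f x)) ≤
        liminf (fun n => ∫⁻ x, ENNReal.ofReal (lipSlope (fun x => cutoff k t (g n x)) x) ∂m)
          atTop :=
      sInf_le ⟨fun n x => cutoff k t (g n x), fun n => (hg n).comp (cutoff_lip k t),
        cutoff_comp_tendsto hgf k t, rfl⟩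
    refine this.trans (liminf_le_liminf (Eventually.of_forall fun n => lintegral_mono fun x => ?_))
    refine (ENNReal.ofReal_le_ofReal (lipSlope_cutoff (hg n) k t x)).trans ?_
    unfold kern
    split_ifs with h
    · rw [Set.indicator_of_mem (by exact h)]
    · simp
  calc _ ≤ ∫⁻ t in Set.Ioi (0:ℝ),
        liminf (fun k => liminf (fun n => ∫⁻ x, kern (g n) k t x ∂m) atTop) atTop :=
        setLIntegral_mono' measurableSet_Ioi key
    _ ≤ liminf (fun k => ∫⁻ t in Set.Ioi (0:ℝ),
          liminf (fun n => ∫⁻ x, kern (g n) k t x ∂m) atTop) atTop :=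
        lintegral_liminf_le fun k => Measurable.liminf fun n => kern_lintegral_measurable (hg n) k
    _ ≤ liminf (fun k : ℕ => liminf (fun n => ∫⁻ x, ENNReal.ofReal (lipSlope (g n) x) ∂m) atTop)
          atTop := by
        refine liminf_le_liminf (Eventually.of_forall fun k => ?_)
        refine (lintegral_liminf_le fun n => kern_lintegral_measurable (hg n) k).trans ?_
        exact liminf_le_liminf (Eventually.of_forall fun n => kern_lintegral (hg n) k)
    _ = _ := by simp

lemma step_bounds {N : ℝ} (hN : 0 < N) {s : ℕ → ℝ}
    (hs : ∀ j : ℕ, ((j:ℝ) + 1) / N ≤ s j ∧ s j < ((j:ℝ) + 2) / N) {y : ℝ} (hy : 0 ≤ y) (M : ℕ) :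
    min y (M / N) - 2 / N ≤ ∑ j ∈ Finset.range M, N⁻¹ * (if s j < y then 1 else 0) ∧
    ∑ j ∈ Finset.range M, N⁻¹ * (if s j < y then 1 else 0) ≤ y := by
  constructor
  · have h1 := Finset.sum_range_sub (fun j : ℕ => min y (((j:ℝ) + 2) / N)) M
    have h2 : ∑ j ∈ Finset.range M, (min y ((((j + 1 : ℕ):ℝ) + 2) / N) - min y (((j:ℝ) + 2) / N)) ≤
        ∑ j ∈ Finset.range M, N⁻¹ * (if s j < y then 1 else 0) := by
      refine Finset.sum_le_sum fun j _ => ?_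
      have e : (((j + 1 : ℕ):ℝ) + 2) / N = ((j:ℝ) + 2) / N + N⁻¹ := by
        push_cast; field_simp; ring
      have hp : 0 < N⁻¹ := by positivity
      rw [e]
      split_ifs with h
      · rcases le_total y (((j:ℝ) + 2) / N) with h3 | h3
        · rw [min_eq_left h3, min_eq_left (by linarith)]; linarith
        · rw [min_eq_right h3]
          linarith [min_le_right y (((j:ℝ) + 2) / N + N⁻¹)]
      · have := (hs j).2
        rw [min_eq_left (by linarith), min_eq_left (by linarith)]; linarith
    refine le_trans ?_ h2
    rw [h1]
    have h3 : min y (M / N) ≤ min y (((M:ℝ) + 2) / N) := by gcongr; linarith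
    have h4 := min_le_right y ((((0:ℕ):ℝ) + 2) / N)
    simp only [Nat.cast_zero, zero_add] at h4 ⊢
    linarith
  · have h1 := Finset.sum_range_sub (fun j : ℕ => min y ((j:ℝ) / N)) M
    have h2 : ∑ j ∈ Finset.range M, N⁻¹ * (if s j < y then 1 else 0) ≤
       ∑ j ∈ Finset.range M, (min y (((j + 1 : ℕ):ℝ) / N) - min y ((j:ℝ) / N)) := by
      refine Finset.sum_le_sum fun j _ => ?_
      have e : ((j + 1 : ℕ):ℝ) / N = (j:ℝ) / N + N⁻¹ := by
        push_cast; field_simp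
      have e' : ((j:ℝ) + 1) / N = (j:ℝ) / N + N⁻¹ := by field_simp
      have hp : 0 < N⁻¹ := by positivity
      rw [e]
      split_ifs with h
      · have := (hs j).1
        rw [min_eq_right (by linarith), min_eq_right (by linarith)]; linarith
      · have : min y ((j:ℝ) / N) ≤ min y ((j:ℝ) / N + N⁻¹) := by gcongr; linarith
        linarith
    refine h2.trans ?_
    rw [h1]
    simp [hy]

lemma exists_level (h : ℝ → ℝ≥0∞) {a b : ℝ} {c : NNReal} (hab : b - a = c) (hc : 0 < c)
    {δ : ℝ≥0∞} (hδ : 0 < δ) (hfin : ∫⁻ t in Set.Ico a b, h t ≠ ⊤) :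
    ∃ s, (a ≤ s ∧ s < b) ∧ c * h s ≤ (∫⁻ t in Set.Ico a b, h t) + δ := by
  by_contra! H
  have hc0 : (c:ℝ≥0∞) ≠ 0 := by exact_mod_cast hc.ne'
  have hct : (c:ℝ≥0∞) ≠ ⊤ := ENNReal.coe_ne_top
  set A := ∫⁻ t in Set.Ico a b, h t with hA
  have h1 : ∫⁻ t in Set.Ico a b, (A + δ) / c ≤ A := by
    refine setLIntegral_mono' measurableSet_Ico fun t ht => ?_
    rw [ENNReal.div_le_iff_le_mul (Or.inl hc0) (Or.inl hct), mul_comm]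
    exact (H t ht).le
  rw [setLIntegral_const, Real.volume_Ico, hab, ENNReal.ofReal_coe_nnreal,
    ENNReal.div_mul_cancel hc0 hct] at h1
  exact absurd h1 (not_le.2 (ENNReal.lt_add_right hfin hδ.ne'))

lemma le_coarea {f : X → ℝ} (hnonneg : ∀ x, 0 ≤ f x) (hf : Integrable f m) :
    totalVar m f ≤ ∫⁻ t in Set.Ioi (0:ℝ), perimeter m {x | t < f x} := by
  have hfm := hf.aemeasurable
  set h : ℝ → ℝ≥0∞ := fun t => perimeter m {x | t < f x} with hh
  refine ENNReal.le_of_forall_pos_le_add fun ε hε hF => ?_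
  have hε' : (0:ℝ≥0∞) < ε := by exact_mod_cast hε
  have hsub : ∀ n j : ℕ, Set.Ico (((j:ℝ) + 1) / ((n:ℝ) + 1)) (((j:ℝ) + 2) / ((n:ℝ) + 1)) ⊆
      Set.Ioi (0:ℝ) := by
    intro n j t ht
    have : 0 < ((j:ℝ) + 1) / ((n:ℝ) + 1) := by positivity
    exact lt_of_lt_of_le this ht.1
  have hex : ∀ n j : ℕ, ∃ s : ℝ, (((j:ℝ) + 1) / ((n:ℝ) + 1) ≤ s ∧ s < ((j:ℝ) + 2) / ((n:ℝ) + 1)) ∧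
      (((n:NNReal) + 1)⁻¹ : NNReal) * h s ≤
        (∫⁻ t in Set.Ico (((j:ℝ) + 1) / ((n:ℝ) + 1)) (((j:ℝ) + 2) / ((n:ℝ) + 1)), h t)
          + ε / (((n + 1) ^ 2 : ℕ) : ℝ≥0∞) := by
    intro n j
    refine exists_level h ?_ (by positivity) ?_ ?_
    · push_cast
      field_simp
      ring
    · exact ENNReal.div_pos hε'.ne' (ENNReal.natCast_ne_top _)
    · exact ((lintegral_mono_set (hsub n j)).trans_lt hF).ne
  choose s hs1 hs2 using hex
  let v : ℕ → X → ℝ := fun n x => ∑ j ∈ Finset.range ((n + 1) ^ 2),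
    ((((n:NNReal) + 1)⁻¹ : NNReal) : ℝ) * {x | s n j < f x}.indicator (fun _ => (1:ℝ)) x
  have hvm' : ∀ n j : ℕ, AEMeasurable (fun x => ((((n:NNReal) + 1)⁻¹ : NNReal) : ℝ) *
      {x | s n j < f x}.indicator (fun _ => (1:ℝ)) x) m := fun n j =>
    (aemeasurable_superlevel hfm (s n j)).const_mul _
  have hvm : ∀ n, AEMeasurable (v n) m := fun n =>
    Finset.aemeasurable_fun_sum _ fun j _ => hvm' n j
  have hvb : ∀ (n : ℕ) (x : X), min (f x) ((n:ℝ) + 1) - 2 / ((n:ℝ) + 1) ≤ v n x ∧ v n x ≤ f x := by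
    intro n x
    have hN : (0:ℝ) < (n:ℝ) + 1 := by positivity
    have := step_bounds hN (hs1 n) (hnonneg x) ((n + 1) ^ 2)
    have e1 : (((n + 1) ^ 2 : ℕ) : ℝ) / ((n:ℝ) + 1) = (n:ℝ) + 1 := by
      push_cast
      field_simp
    have e2 : v n x = ∑ j ∈ Finset.range ((n + 1) ^ 2),
        ((n:ℝ) + 1)⁻¹ * (if s n j < f x then 1 else 0) := by
      refine Finset.sum_congr rfl fun j _ => ?_
      simp [Set.indicator_apply]
    rw [e1, ← e2] at this
    exact this
  have hconv : Tendsto (fun n => ∫⁻ x, ENNReal.ofReal |v n x - f x| ∂m) atTop (𝓝 0) := by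
    have hv0 : ∀ n x, 0 ≤ v n x := fun n x => Finset.sum_nonneg fun j _ =>
      mul_nonneg (NNReal.coe_nonneg _) (Set.indicator_nonneg (fun _ _ => zero_le_one) _)
    have := tendsto_lintegral_of_dominated_convergence' (μ := m)
      (F := fun (n : ℕ) x => ENNReal.ofReal |v n x - f x|) (f := fun _ => 0)
      (fun x => ENNReal.ofReal (f x)) ?_ ?_ hf.lintegral_lt_top.ne ?_
    · simpa using this
    · intro n
      exact (((hvm n).sub hfm).abs).ennreal_ofReal
    · intro n
      refine Eventually.of_forall fun x => ENNReal.ofReal_le_ofReal ?_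
      rw [abs_le]
      constructor <;> linarith [(hvb n x).2, hv0 n x, hnonneg x]
    · refine Eventually.of_forall fun x => ?_
      have hlim : Tendsto (fun n : ℕ => 2 * (1 / ((n:ℝ) + 1))) atTop (𝓝 (2 * 0)) :=
        tendsto_one_div_add_atTop_nhds_zero_nat.const_mul 2
      rw [mul_zero] at hlim
      have hlim2 := ENNReal.tendsto_ofReal hlim
      rw [ENNReal.ofReal_zero] at hlim2
      refine tendsto_of_tendsto_of_tendsto_of_le_of_le' tendsto_const_nhds hlim2
        (Eventually.of_forall fun n => zero_le) ?_
      obtain ⟨n0, hn0⟩ := exists_nat_ge (f x)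
      filter_upwards [eventually_ge_atTop n0] with n hn
      refine ENNReal.ofReal_le_ofReal ?_
      have hb := hvb n x
      have hnn : (n0:ℝ) ≤ n := by exact_mod_cast hn
      rw [min_eq_left (by linarith)] at hb
      rw [mul_one_div, abs_le]
      have : 0 ≤ 2 / ((n:ℝ) + 1) := by positivity
      constructor <;> linarith
  have hbound : ∀ n, totalVar m (v n) ≤ (∫⁻ t in Set.Ioi (0:ℝ), h t) + ε := by
    intro n
    calc totalVar m (v n) ≤ _ := totalVar_sum_le _ (hvm' n) _
      _ ≤ ∑ j ∈ Finset.range ((n + 1) ^ 2), ((((n:NNReal) + 1)⁻¹ : NNReal) : ℝ≥0∞) * h (s n j) :=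
          Finset.sum_le_sum fun j _ => totalVar_smul_le (by positivity)
      _ ≤ ∑ j ∈ Finset.range ((n + 1) ^ 2),
          ((∫⁻ t in Set.Ico (((j:ℝ) + 1) / ((n:ℝ) + 1)) (((j:ℝ) + 2) / ((n:ℝ) + 1)), h t)
          + ε / (((n + 1) ^ 2 : ℕ) : ℝ≥0∞)) := Finset.sum_le_sum fun j _ => hs2 n j
      _ = (∑ j ∈ Finset.range ((n + 1) ^ 2),
          ∫⁻ t in Set.Ico (((j:ℝ) + 1) / ((n:ℝ) + 1)) (((j:ℝ) + 2) / ((n:ℝ) + 1)), h t) + ε := by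
          rw [Finset.sum_add_distrib]
          congr 1
          rw [Finset.sum_const, Finset.card_range, nsmul_eq_mul]
          exact ENNReal.mul_div_cancel (by simp) (ENNReal.natCast_ne_top _)
      _ ≤ _ := by
          gcongr
          rw [← lintegral_biUnion_finset _ (fun j _ => measurableSet_Ico)]
          · exact lintegral_mono_set (Set.iUnion₂_subset fun j _ => hsub n j)
          · intro i _ j _ hij
            have key : ∀ i j : ℕ, i < j → Disjoint
                (Set.Ico (((i:ℝ) + 1) / ((n:ℝ) + 1)) (((i:ℝ) + 2) / ((n:ℝ) + 1)))
                (Set.Ico (((j:ℝ) + 1) / ((n:ℝ) + 1)) (((j:ℝ) + 2) / ((n:ℝ) + 1))) := by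
              intro i j hij
              rw [Set.disjoint_left]
              intro t h1 h2
              have h3 : ((i:ℝ) + 2) / ((n:ℝ) + 1) ≤ ((j:ℝ) + 1) / ((n:ℝ) + 1) := by
                have : (i:ℝ) + 1 ≤ j := by exact_mod_cast hij
                gcongr ?_ / _
                linarith
              linarith [h1.2, h2.1]
            rcases lt_or_gt_of_ne hij with h1 | h1
            · exact key i j h1
            · exact (key j i h1).symm
  refine (totalVar_lsc hvm hconv).trans ?_
  calc _ ≤ liminf (fun _ : ℕ => (∫⁻ t in Set.Ioi (0:ℝ), h t) + ε) atTop :=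
        liminf_le_liminf (Eventually.of_forall hbound)
    _ = _ := by simp

end Main

/-- Coarea formula for BV functions: for a complete separable metric space with a Borel
measure finite on bounded sets and a nonnegative `f ∈ BV(X,d,m)`,
`∫_0^∞ Per({f > t}) dt = |Df|(X)`. -/
theorem coarea_formula_BV {X : Type*} [MetricSpace X] [CompleteSpace X]
    [TopologicalSpace.SeparableSpace X] [MeasurableSpace X] [BorelSpace X]
    (m : Measure X)
    (hbdd : ∀ s : Set X, Bornology.IsBounded s → m s < ⊤)
    (f : X → ℝ) (hnonneg : ∀ x, 0 ≤ f x) (hf : MemBV m f) :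
    ∫⁻ t in Set.Ioi (0:ℝ), perimeter m {x | t < f x} = totalVar m f := by
  haveI : SecondCountableTopology X := UniformSpace.secondCountable_of_separable X
  haveI : IsLocallyFiniteMeasure m :=
    ⟨fun x => ⟨Metric.ball x 1, Metric.ball_mem_nhds x one_pos, hbdd _ Metric.isBounded_ball⟩⟩
  exact le_antisymm (coarea_le hnonneg hf.1) (le_coarea hnonneg hf.1)
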